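/- Let ε ∈ {0, 1}, let f₆ : ℝ → ℝ be a C² function whose derivative f₆′ is nowhere zero, and let φ : ℝ⁶ → ℝ be a C² function satisfying, at every point x = (x¹,…,x⁶) ∈ ℝ⁶: (i) ∂₁φ = 0, ∂₂φ = 0, ∂₃φ = 0 and ∂₄φ = 0; (ii) 5ε·∂₆φ(x) = f₆′(x⁶)·∂₅φ(x); (iii) f₆′(x⁶)·∂₆∂₆φ(x) = f₆″(x⁶)·∂₆φ(x); (iv) ∂₅∂₆φ = 0. Then there exist constants a₁, c ∈ ℝ such that φ(x) = (a₁/2)(5ε·x⁵ + f₆(x⁶)) + c for all x ∈ ℝ⁶. -/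

import Mathlib

/-- Partial derivative of `φ : ℝ⁶ → ℝ` in the `i`-th coordinate direction
(`i : Fin 6` is the 0-based index, so `∂ᵢφ` of the paper is `pd (i-1) φ`). -/
noncomputable def pd (i : Fin 6) (φ : (Fin 6 → ℝ) → ℝ) : (Fin 6 → ℝ) → ℝ :=
  fun x => fderiv ℝ φ x (Pi.single i 1)

theorem eq_of_pd_eq_zero {f : (Fin 6 → ℝ) → ℝ} (hf : Differentiable ℝ f)
    (h : ∀ i x, pd i f x = 0) (x y : Fin 6 → ℝ) : f x = f y := by
  refine is_const_of_fderiv_eq_zero hf (fun z => ?_) x y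
  refine ContinuousLinearMap.coe_injective ((Pi.basisFun ℝ (Fin 6)).ext fun i => ?_)
  simpa [pd] using h i z

theorem pd_comm {φ : (Fin 6 → ℝ) → ℝ} (hφ : ContDiff ℝ 2 φ) (i j : Fin 6) (x : Fin 6 → ℝ) :
    pd i (pd j φ) x = pd j (pd i φ) x := by
  have hd : DifferentiableAt ℝ (fderiv ℝ φ) x :=
    (hφ.fderiv_right (m := 1) (by norm_num)).differentiable (by norm_num) x
  have key : ∀ i j, pd i (pd j φ) x
      = fderiv ℝ (fderiv ℝ φ) x (Pi.single i 1) (Pi.single j 1) := by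
    intro i j
    have h := hd.hasFDerivAt.clm_apply (hasFDerivAt_const (Pi.single j (1 : ℝ)) x)
    change fderiv ℝ (fun y => fderiv ℝ φ y (Pi.single j 1)) x (Pi.single i 1) = _
    rw [h.fderiv]
    simp
  rw [key, key]
  exact (hφ.contDiffAt.isSymmSndFDerivAt (by simp)).eq _ _

theorem differentiable_pd {φ : (Fin 6 → ℝ) → ℝ} (hφ : ContDiff ℝ 2 φ) (i : Fin 6) :
    Differentiable ℝ (pd i φ) :=
  ((hφ.fderiv_right (m := 1) (by norm_num)).differentiable (by norm_num)).clm_apply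
    (differentiable_const _)

theorem hasFDerivAt_comp_coord {g : ℝ → ℝ} (hg : Differentiable ℝ g) (j : Fin 6)
    (x : Fin 6 → ℝ) :
    HasFDerivAt (fun y : Fin 6 → ℝ => g (y j))
      (deriv g (x j) • ContinuousLinearMap.proj (R := ℝ) (φ := fun _ : Fin 6 => ℝ) j) x :=
  (hg (x j)).hasDerivAt.comp_hasFDerivAt x (hasFDerivAt_apply j x)

/-- Integration of the Eisenhart equations for the defining function of a
projective motion on the rigid 6-dimensional h-space of type [51] (generic case
f₆′ nowhere zero). Coordinates: x¹,…,x⁶ are `x 0, …, x 5`. -/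
theorem stmt_7 (ε : ℝ) (hε : ε = 0 ∨ ε = 1)
    (f₆ : ℝ → ℝ) (hf₆ : ContDiff ℝ 2 f₆) (hf₆' : ∀ t : ℝ, deriv f₆ t ≠ 0)
    (φ : (Fin 6 → ℝ) → ℝ) (hφ : ContDiff ℝ 2 φ)
    -- (i) ∂₁φ = 0, ∂₂φ = 0, ∂₃φ = 0, ∂₄φ = 0
    (h1 : ∀ x, pd 0 φ x = 0) (h2 : ∀ x, pd 1 φ x = 0)
    (h3 : ∀ x, pd 2 φ x = 0) (h4 : ∀ x, pd 3 φ x = 0)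
    -- (ii) 5ε·∂₆φ = f₆′·∂₅φ
    (h56 : ∀ x, 5 * ε * pd 5 φ x = deriv f₆ (x 5) * pd 4 φ x)
    -- (iii) f₆′·∂₆∂₆φ = f₆″·∂₆φ
    (h66 : ∀ x, deriv f₆ (x 5) * pd 5 (pd 5 φ) x = deriv (deriv f₆) (x 5) * pd 5 φ x)
    -- (iv) ∂₅∂₆φ = 0
    (h56' : ∀ x, pd 4 (pd 5 φ) x = 0) :
    ∃ a₁ c : ℝ, ∀ x : Fin 6 → ℝ,
      φ x = (a₁ / 2) * (5 * ε * x 4 + f₆ (x 5)) + c := by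
  have hf : Differentiable ℝ f₆ := hf₆.differentiable (by norm_num)
  have hdf : Differentiable ℝ (deriv f₆) :=
    (ContDiff.deriv' (n := 1) (by simpa [one_add_one_eq_two] using hf₆)).differentiable (by norm_num)
  have mixed : ∀ i, (∀ x, pd i φ x = 0) → ∀ x, pd i (pd 5 φ) x = 0 := by
    intro i hi x
    rw [pd_comm hφ, show pd i φ = fun _ => 0 from funext hi]
    simp [pd]
  have hinv : Differentiable ℝ (fun t => (deriv f₆ t)⁻¹) := hdf.inv hf₆'
  have hratio : ∀ x, HasFDerivAt (fun y : Fin 6 → ℝ => pd 5 φ y * (deriv f₆ (y 5))⁻¹) _ x :=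
    fun x => (differentiable_pd hφ 5 x).hasFDerivAt.mul (hasFDerivAt_comp_coord hinv 5 x)
  have hderiv : ∀ t, deriv (fun t => (deriv f₆ t)⁻¹) t
      = -deriv (deriv f₆) t / deriv f₆ t ^ 2 :=
    fun t => ((hdf t).hasDerivAt.fun_inv (hf₆' t)).deriv
  have hconst := eq_of_pd_eq_zero (fun x => (hratio x).differentiableAt) (by
    intro i x
    have hi : pd i (fun y : Fin 6 → ℝ => pd 5 φ y * (deriv f₆ (y 5))⁻¹) x
        = pd 5 φ x * (deriv (fun t => (deriv f₆ t)⁻¹) (x 5) * (Pi.single i (1 : ℝ) : Fin 6 → ℝ) 5)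
          + (deriv f₆ (x 5))⁻¹ * pd i (pd 5 φ) x := by
      rw [pd, (hratio x).fderiv]
      simp [pd]
    rw [hi, hderiv]
    have hne := hf₆' (x 5)
    fin_cases i
    · simp [mixed 0 h1 x]
    · simp [mixed 1 h2 x]
    · simp [mixed 2 h3 x]
    · simp [mixed 3 h4 x]
    · simp [h56' x]
    · have := h66 x
      simp only [Fin.reduceFinMk, Pi.single_eq_same]
      field_simp
      linarith)
  obtain ⟨k, hk⟩ : ∃ k, ∀ x, pd 5 φ x = k * deriv f₆ (x 5) :=
    ⟨_, fun x => (mul_inv_eq_iff_eq_mul₀ (hf₆' _)).1 (hconst x 0)⟩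
  have hk4 : ∀ x, pd 4 φ x = 5 * ε * k := fun x => by
    apply mul_left_cancel₀ (hf₆' (x 5))
    rw [← h56, hk]
    ring
  have hdiff : ∀ x, HasFDerivAt
      (fun y : Fin 6 → ℝ => φ y - k * (5 * ε * y 4 + f₆ (y 5))) _ x := fun x =>
    (hφ.differentiable (by norm_num) x).hasFDerivAt.sub
      ((((hasFDerivAt_apply (𝕜 := ℝ) (4 : Fin 6) x).const_mul (5 * ε)).add
        (hasFDerivAt_comp_coord hf 5 x)).const_mul k)
  have hrest := eq_of_pd_eq_zero (fun x => (hdiff x).differentiableAt) (by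
    intro i x
    have hi : pd i (fun y : Fin 6 → ℝ => φ y - k * (5 * ε * y 4 + f₆ (y 5))) x
        = pd i φ x - k * (5 * ε * (Pi.single i (1 : ℝ) : Fin 6 → ℝ) 4
          + deriv f₆ (x 5) * (Pi.single i (1 : ℝ) : Fin 6 → ℝ) 5) := by
      rw [pd, (hdiff x).fderiv]
      simp [pd, mul_add]
    rw [hi]
    fin_cases i
    · simp [h1 x]
    · simp [h2 x]
    · simp [h3 x]
    · simp [h4 x]
    · simp [hk4 x, mul_comm]
    · simp [hk x])
  refine ⟨2 * k, φ 0 - k * (5 * ε * (0 : Fin 6 → ℝ) 4 + f₆ ((0 : Fin 6 → ℝ) 5)), fun x => ?_⟩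
  linear_combination hrest x 0
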